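/- Suppose a Social Welfare Function w : P̄^N → P̄ admits profiles q, q' ∈ P^N with w(q) = w(q') = 𝐜 and q inconsistent with q' (i.e., q_j ⊓ q'_j = 𝐜 for some coordinate j), as is guaranteed by Arrow's Impossibility Theorem when w satisfies Unanimity, IIA and Non-Dictatorship. Then for every application function app : P̄^N × P̄ → P̄^N, the Self-Reference System (w, app) has no consistency-respecting expression with respect to the valid elements P^N: there is no Υ ∈ P̄^N such that for all d, d' ∈ P^N, d ⋈ d' ⟺ app(Υ, w(d)) ⋈ app(Υ, w(d')). -/

import Mathlib

/-- A weak order on `A`: a transitive and complete (total) binary relation. -/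
structure WeakOrder (A : Type*) where
  rel : A → A → Prop
  trans : ∀ a b c, rel a b → rel b c → rel a c
  total : ∀ a b, rel a b ∨ rel b a

namespace WeakOrder

/-- Strict preference: `a ≺ b` in `r`. -/
def strict {A : Type*} (r : WeakOrder A) (a b : A) : Prop := r.rel a b ∧ ¬ r.rel b a

/-- The reversed (converse) weak order. -/
def reverse {A : Type*} (r : WeakOrder A) : WeakOrder A :=
  ⟨fun a b => r.rel b a, fun a b c h1 h2 => r.trans c b a h2 h1, fun a b => r.total b a⟩

end WeakOrder

/-- The totally indifferent weak order `𝐢`. -/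
def indiff (A : Type*) : WeakOrder A :=
  ⟨fun _ _ => True, fun _ _ _ _ _ => trivial, fun _ _ => Or.inl trivial⟩

/-- The strictness ordering on weak orders: `r ≤ s` iff every strict
preference of `s` is a strict preference of `r`. -/
def strLE {A : Type*} (r s : WeakOrder A) : Prop :=
  ∀ a b, s.strict a b → r.strict a b

/-- `P̄ = P ∪ {𝐜}`, with `none` playing the role of the contradictory
preference cycle `𝐜` and `some r` the weak order `r`. -/
abbrev Pbar (A : Type*) := Option (WeakOrder A)

/-- The strictness ordering extended to `P̄`, with `𝐜 = none` as bottom. -/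
def barLE {A : Type*} : Pbar A → Pbar A → Prop
  | none, _ => True
  | some _, none => False
  | some r, some s => strLE r s

/-- `t` is a greatest lower bound of `r` and `s` in `(P̄, ≤)`. -/
def IsGLBbar {A : Type*} (r s t : Pbar A) : Prop :=
  barLE t r ∧ barLE t s ∧ ∀ u, barLE u r → barLE u s → barLE u t

/-- `t` is a least upper bound of `r` and `s` in `(P̄, ≤)`. -/
def IsLUBbar {A : Type*} (r s t : Pbar A) : Prop :=
  barLE r t ∧ barLE s t ∧ ∀ u, barLE r u → barLE s u → barLE t u

open Classical in
/-- `r ⊓ s`: the greatest lower bound of `r` and `s` in `(P̄, ≤)` (which always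
exists; `𝐜` as a default value otherwise). -/
noncomputable def pinf {A : Type*} (r s : Pbar A) : Pbar A :=
  if h : ∃ t, IsGLBbar r s t then h.choose else none

/-- `t` is a least upper bound of the weak orders `r` and `s` in the
strictness ordering on `P`. -/
def IsLUBw {A : Type*} (r s t : WeakOrder A) : Prop :=
  strLE r t ∧ strLE s t ∧ ∀ u, strLE r u → strLE s u → strLE t u

/-- `t` is a greatest lower bound of the weak orders `r` and `s` in the
strictness ordering on `P`. -/
def IsGLBw {A : Type*} (r s t : WeakOrder A) : Prop :=
  strLE t r ∧ strLE t s ∧ ∀ u, strLE u r → strLE u s → strLE u t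

open Classical in
/-- `r ⊔ s`: the least upper bound of two weak orders in the strictness
ordering (which always exists; default value otherwise). -/
noncomputable def wsup {A : Type*} (r s : WeakOrder A) : WeakOrder A :=
  if h : ∃ t, IsLUBw r s t then h.choose else indiff A

/-- The join `+ : P̄ × P̄ → P̄`: `r + s = r ⊔ s` when both are weak orders,
and `𝐢` otherwise. -/
noncomputable def pjoin {A : Type*} : Pbar A → Pbar A → Pbar A
  | some r, some s => some (wsup r s)
  | _, _ => some (indiff A)

open Classical in
/-- Negation on `P̄`: `¬𝐜 = 𝐢`, `¬𝐢 = 𝐜`, and otherwise the weak order with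
all strict preferences reversed. -/
noncomputable def pneg {A : Type*} : Pbar A → Pbar A
  | none => some (indiff A)
  | some r => if r = indiff A then none else some r.reverse

/-- The inclusion `P^N ⊆ P̄^N` of profiles of weak orders. -/
def coeP {A : Type*} {N : ℕ} (p : Fin N → WeakOrder A) : Fin N → Pbar A :=
  fun j => some (p j)

/-- `w` has a dictator at individual `i`. -/
def HasDictatorAt {A : Type*} {N : ℕ} (w : (Fin N → Pbar A) → Pbar A) (i : Fin N) : Prop :=
  ∀ p : Fin N → WeakOrder A,
    (w (coeP p) = none → p i = indiff A) ∧
    (p i ≠ indiff A → barLE (w (coeP p)) (some (p i)))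

/-- The application function `Ω_i`. -/
noncomputable def Omega {A : Type*} {N : ℕ} (i : Fin N) (p : Fin N → Pbar A) (r : Pbar A) :
    Fin N → Pbar A :=
  fun j => if j = i then pinf (p i) r else none

/-- The `i`-th indicator `Υ_i`: `𝐢` in coordinate `i` and `𝐜` elsewhere. -/
def indicator {A : Type*} {N : ℕ} (i : Fin N) : Fin N → Pbar A :=
  fun j => if j = i then some (indiff A) else none

/-- Coordinatewise negation on tuples. -/
noncomputable def negT {A : Type*} {N : ℕ} (p : Fin N → Pbar A) : Fin N → Pbar A :=
  fun j => pneg (p j)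

/-- Coordinatewise extended strictness order on tuples. -/
def leT {A : Type*} {N : ℕ} (s t : Fin N → Pbar A) : Prop :=
  ∀ j, barLE (s j) (t j)

/-- `p ∗ q := Ω_i(p, w(q))` in the Self-Reference System `(w, Ω_i)`. -/
noncomputable def starOmega {A : Type*} {N : ℕ} (w : (Fin N → Pbar A) → Pbar A) (i : Fin N)
    (p q : Fin N → Pbar A) : Fin N → Pbar A :=
  Omega i p (w q)

/-- Two tuples are consistent (`s ⋈ t`) iff `s_j ⊓ t_j ≠ 𝐜` in every coordinate. -/
def Consistent {A : Type*} {N : ℕ} (s t : Fin N → Pbar A) : Prop :=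
  ∀ j, pinf (s j) (t j) ≠ none

/-- `(Υ, d)` satisfies quasi-consistency in `(w, Ω_i)`: `d ≤ ¬(Υ ∗ ¬d)`. -/
noncomputable def QuasiConsistent {A : Type*} {N : ℕ} (w : (Fin N → Pbar A) → Pbar A)
    (i : Fin N) (Υ d : Fin N → Pbar A) : Prop :=
  leT d (negT (starOmega w i Υ (negT d)))

/-- `d` is a quasi-Gödel sentence w.r.t. `Υ` in `(w, Ω_i)`: `d ≤ ¬(Υ ∗ d)`. -/
noncomputable def QuasiGodelSentence {A : Type*} {N : ℕ} (w : (Fin N → Pbar A) → Pbar A)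
    (i : Fin N) (Υ d : Fin N → Pbar A) : Prop :=
  leT d (negT (starOmega w i Υ d))

/-- `(Υ, d)` satisfies quasi-completeness in `(w, Ω_i)`:
`¬(Υ ∗ d)` and `¬(Υ ∗ ¬d)` are inconsistent. -/
noncomputable def QuasiComplete {A : Type*} {N : ℕ} (w : (Fin N → Pbar A) → Pbar A)
    (i : Fin N) (Υ d : Fin N → Pbar A) : Prop :=
  ¬ Consistent (negT (starOmega w i Υ d)) (negT (starOmega w i Υ (negT d)))

/-- `(w, Ω_i)` is a quasi-Gödelian system with respect to `Υ`. -/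
noncomputable def QuasiGodelian {A : Type*} {N : ℕ} (w : (Fin N → Pbar A) → Pbar A)
    (i : Fin N) (Υ : Fin N → Pbar A) : Prop :=
  ∃ d : Fin N → WeakOrder A,
    QuasiGodelSentence w i Υ (coeP d) ∧
    ¬ (QuasiConsistent w i Υ (coeP d) ∧ QuasiComplete w i Υ (coeP d))

/-- `a ≺ b` in `x ∈ P̄` (`𝐜` is regarded as containing every strict preference). -/
def strictIn {A : Type*} (x : Pbar A) (a b : A) : Prop :=
  match x with
  | none => True
  | some r => r.strict a b

/-- Unanimity for an extended Social Welfare Function. -/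
def Unanimity {A : Type*} {N : ℕ} (w : (Fin N → Pbar A) → Pbar A) : Prop :=
  ∀ (p : Fin N → WeakOrder A) (a b : A),
    (∀ j, (p j).strict a b) → strictIn (w (coeP p)) a b

/-- Independence of Irrelevant Alternatives for an extended Social Welfare Function. -/
def IIA {A : Type*} {N : ℕ} (w : (Fin N → Pbar A) → Pbar A) : Prop :=
  ∀ (p q : Fin N → WeakOrder A) (a b : A),
    (∀ j, ((p j).strict a b ↔ (q j).strict a b) ∧ ((p j).strict b a ↔ (q j).strict b a)) →
    ((strictIn (w (coeP p)) a b ↔ strictIn (w (coeP q)) a b) ∧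
     (strictIn (w (coeP p)) b a ↔ strictIn (w (coeP q)) b a))

theorem isGLBbar_self {A : Type*} (r : Pbar A) : IsGLBbar r r r := by
  have hr : barLE r r := by
    cases r with
    | none => trivial
    | some r => exact fun _ _ h => h
  exact ⟨hr, hr, fun _ h _ => h⟩

/-- The meet of a weak order with itself is not the contradictory cycle. -/
theorem pinf_some_self_ne_none {A : Type*} (r : WeakOrder A) :
    pinf (some r) (some r) ≠ none := by
  have h : ∃ t, IsGLBbar (some r) (some r) t := ⟨_, isGLBbar_self (some r)⟩
  have hle : barLE (some r) h.choose :=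
    h.choose_spec.2.2 _ (isGLBbar_self (some r)).1 (isGLBbar_self (some r)).1
  intro hn
  rw [pinf, dif_pos h] at hn
  rw [hn] at hle
  exact hle

/-- Every profile of weak orders is consistent with itself. -/
theorem consistent_coeP_self {A : Type*} {N : ℕ} (p : Fin N → WeakOrder A) :
    Consistent (coeP p) (coeP p) :=
  fun j => pinf_some_self_ne_none (p j)

/-- If `w` admits profiles `q, q' ∈ P^N` with
`w(q) = w(q') = 𝐜` and `q` inconsistent with `q'`, then for every application
function `app`, the Self-Reference System `(w, app)` has no
consistency-respecting expression `Υ` with respect to the valid elements `P^N`. -/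
theorem no_consistency_respecting {A : Type*} {N : ℕ}
    (w : (Fin N → Pbar A) → Pbar A)
    (q q' : Fin N → WeakOrder A)
    (hq : w (coeP q) = none) (hq' : w (coeP q') = none)
    (hinc : ∃ j : Fin N, pinf (some (q j)) (some (q' j)) = none) :
    ∀ app : (Fin N → Pbar A) → Pbar A → (Fin N → Pbar A),
      ¬ ∃ Υ : Fin N → Pbar A,
        ∀ d d' : Fin N → WeakOrder A,
          Consistent (coeP d) (coeP d') ↔
            Consistent (app Υ (w (coeP d))) (app Υ (w (coeP d'))) := by
  rintro app ⟨Υ, h⟩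
  obtain ⟨j, hj⟩ := hinc
  have he := (h q q).1 (consistent_coeP_self q)
  rw [hq] at he
  have hqq' := h q q'
  rw [hq, hq'] at hqq'
  exact hqq'.2 he j hj
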